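/- Let α > 0, let θ = θ̃_α be the unique zero of L(α,·) in (0, θ⁺_α) ∩ (0, π/4), and let φ, β, G, U be as in the context. Define λ : ℝ² → ℝ by λ(u,v) = (G'(u)² + C²)·cosh²(αv + β(u)) and κ = −(1/2)·(∂²_u + ∂²_v)(log λ). Then: (i) κ takes both positive and negative values on ℝ²; (ii) κ is not integrable on [−U,U] × ℝ, i.e. ∫_{[−U,U]×ℝ} |κ| = +∞ (the horizontal catenoid has points of positive and of negative Gaussian curvature, and infinite total absolute curvature). -/

import Mathlib

open Real Filter

noncomputable def Ccoef (α θ : ℝ) : ℝ := Real.sin (2 * θ) / (2 * α)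

noncomputable def Ppoly (α θ x : ℝ) : ℝ :=
  α ^ 2 + Real.cos (2 * θ) * x ^ 2 - Ccoef α θ ^ 2 * x ^ 4

noncomputable def thetaPlus (α : ℝ) : ℝ :=
  if 1 < α then Real.pi / 2 else (1 / 2) * Real.arccos (1 - 2 * α ^ 2)

def inOmega (α θ : ℝ) : Prop := 0 < α ∧ -thetaPlus α < θ ∧ θ < thetaPlus α

noncomputable def Lint (α θ : ℝ) : ℝ :=
  ∫ x in (-1 : ℝ)..1,
    (2 * α * Ccoef α θ ^ 2 * x ^ 2 - α * Real.cos (2 * θ)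
        + Ccoef α θ ^ 2 * x ^ 2 * Real.sqrt (Ppoly α θ x)) /
      (Real.sqrt ((1 - x ^ 2) * Ppoly α θ x) * (α + Real.sqrt (Ppoly α θ x)))

/-- Wirtinger derivative `f_z = (f_u - i f_v)/2` of a map `f : ℝ² → ℂ`. -/
noncomputable def wz (f : ℝ × ℝ → ℂ) (p : ℝ × ℝ) : ℂ :=
  (deriv (fun t => f (t, p.2)) p.1 - Complex.I * deriv (fun t => f (p.1, t)) p.2) / 2

/-- Wirtinger derivative `f_z̄ = (f_u + i f_v)/2` of a map `f : ℝ² → ℂ`. -/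
noncomputable def wzbar (f : ℝ × ℝ → ℂ) (p : ℝ × ℝ) : ℂ :=
  (deriv (fun t => f (t, p.2)) p.1 + Complex.I * deriv (fun t => f (p.1, t)) p.2) / 2

open Topology MeasureTheory

theorem Real.hasDerivAt_log_cosh (x : ℝ) :
    HasDerivAt (fun y => Real.log (Real.cosh y)) (Real.tanh x) x := by
  rw [Real.tanh_eq_sinh_div_cosh]
  exact (Real.hasDerivAt_cosh x).log (Real.cosh_pos x).ne'

theorem Real.hasDerivAt_tanh_one_sub_sq (x : ℝ) :
    HasDerivAt Real.tanh (1 - Real.tanh x ^ 2) x := by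
  have h := (Real.hasDerivAt_sinh x).div (Real.hasDerivAt_cosh x) (Real.cosh_pos x).ne'
  have e : Real.tanh = Real.sinh / Real.cosh := by
    ext y
    exact Real.tanh_eq_sinh_div_cosh y
  have hx := (Real.cosh_pos x).ne'
  have hd : 1 - Real.tanh x ^ 2 =
      (Real.cosh x * Real.cosh x - Real.sinh x * Real.sinh x) / Real.cosh x ^ 2 := by
    rw [Real.tanh_eq_sinh_div_cosh]
    field_simp
  rwa [← hd, ← e] at h

theorem Real.tendsto_tanh_atTop : Tendsto Real.tanh atTop (𝓝 1) := by
  have e : Real.tanh = fun x => (1 - Real.exp (-(2 * x))) / (1 + Real.exp (-(2 * x))) := by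
    ext x
    have h : Real.exp (-(2 * x)) = Real.exp (-x) / Real.exp x := by
      rw [← Real.exp_sub]
      ring_nf
    rw [Real.tanh_eq, h]
    have := (Real.exp_pos x).ne'
    field_simp
  have h0 : Tendsto (fun x : ℝ => Real.exp (-(2 * x))) atTop (𝓝 0) :=
    Real.tendsto_exp_neg_atTop_nhds_zero.comp (tendsto_id.const_mul_atTop two_pos)
  rw [e]
  have h := (h0.const_sub 1).div (h0.const_add 1) (by norm_num)
  rwa [sub_zero, add_zero, div_one] at h

theorem Real.tendsto_tanh_atBot : Tendsto Real.tanh atBot (𝓝 (-1)) := by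
  have h := (Real.tendsto_tanh_atTop.comp tendsto_neg_atBot_atTop).neg
  refine h.congr fun x => ?_
  simp [Real.tanh_neg]

/-- If `f` has a nonzero limit as the first variable tends to `u₀` and the second one runs along a
filter all of whose members have infinite measure, then `f` is not integrable near the line
over `u₀`. -/
theorem lintegral_strip_eq_top {f : ℝ × ℝ → ℝ} {l : Filter ℝ} {s : Set ℝ} {u₀ c : ℝ}
    (hl : ∀ t ∈ l, ∃ t' ⊆ t, MeasurableSet t' ∧ volume t' = ⊤)
    (hs : s ∈ 𝓝 u₀) (hf : Tendsto f (𝓝 u₀ ×ˢ l) (𝓝 c)) (hc : c ≠ 0) :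
    ∫⁻ p in s ×ˢ (Set.univ : Set ℝ), ENNReal.ofReal |f p| = ⊤ := by
  have hc' : |c| / 2 < |c| := half_lt_self (abs_pos.2 hc)
  obtain ⟨a, ha, t, ht, hat⟩ := mem_prod_iff.1 (hf.abs.eventually_const_lt hc')
  obtain ⟨t', ht', htm, htop⟩ := hl t ht
  obtain ⟨o, hos, ho, hu⟩ := mem_nhds_iff.1 (inter_mem hs ha)
  have hm : MeasurableSet (o ×ˢ t') := ho.measurableSet.prod htm
  have hvol : volume (o ×ˢ t') = ⊤ := by
    rw [Measure.volume_eq_prod, Measure.prod_prod, htop]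
    exact ENNReal.mul_top (ho.measure_pos volume ⟨u₀, hu⟩).ne'
  refine top_le_iff.1 ?_
  calc (⊤ : ENNReal) = ENNReal.ofReal (|c| / 2) * volume (o ×ˢ t') := by
        rw [hvol, ENNReal.mul_top]
        simpa using hc
    _ = ∫⁻ _ in o ×ˢ t', ENNReal.ofReal (|c| / 2) := (setLIntegral_const _ _).symm
    _ ≤ ∫⁻ p in o ×ˢ t', ENNReal.ofReal |f p| :=
        setLIntegral_mono' hm fun p hp => ENNReal.ofReal_le_ofReal
          (le_of_lt (hat ⟨(hos hp.1).2, ht' hp.2⟩))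
    _ ≤ ∫⁻ p in s ×ˢ (Set.univ : Set ℝ), ENNReal.ofReal |f p| :=
        lintegral_mono_set fun p hp => ⟨(hos hp.1).1, trivial⟩

theorem hasDerivAt_deriv_of_contDiff_two {f : ℝ → ℝ} (hf : ContDiff ℝ 2 f) :
    (∀ x, HasDerivAt f (deriv f x) x) ∧
      (∀ x, HasDerivAt (deriv f) (deriv (deriv f) x) x) ∧ Continuous (deriv (deriv f)) := by
  have h1 : ContDiff ℝ 1 (deriv f) := ((contDiff_succ_iff_deriv (n := 1)).1 hf).2.2
  exact ⟨fun x => (hf.differentiable (by norm_num) x).hasDerivAt,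
    fun x => (h1.differentiable (by norm_num) x).hasDerivAt, h1.continuous_deriv le_rfl⟩

/-- The curvature density of the metric `exp h(u) cosh² (αv + β(u)) |dz|²`. -/
theorem curvature_density_eq {α : ℝ} {h β : ℝ → ℝ} (hh : ContDiff ℝ 2 h) (hβ : ContDiff ℝ 2 β)
    (u v : ℝ) :
    -(1 / 2) * (deriv (deriv fun s => h s + 2 * Real.log (Real.cosh (α * v + β s))) u
        + deriv (deriv fun s => h u + 2 * Real.log (Real.cosh (α * s + β u))) v) =
      -(deriv (deriv h) u / 2) - deriv (deriv β) u * Real.tanh (α * v + β u)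
        - (α ^ 2 + deriv β u ^ 2) * (1 - Real.tanh (α * v + β u) ^ 2) := by
  obtain ⟨h1, h2, -⟩ := hasDerivAt_deriv_of_contDiff_two hh
  obtain ⟨b1, b2, -⟩ := hasDerivAt_deriv_of_contDiff_two hβ
  have eu : (deriv fun s => h s + 2 * Real.log (Real.cosh (α * v + β s))) =
      fun s => deriv h s + 2 * (Real.tanh (α * v + β s) * deriv β s) := by
    ext s
    have hw : HasDerivAt (fun s => α * v + β s) (deriv β s) s := (b1 s).const_add _
    exact ((h1 s).add (((Real.hasDerivAt_log_cosh _).comp s hw).const_mul 2)).deriv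
  have ev : (deriv fun s => h u + 2 * Real.log (Real.cosh (α * s + β u))) =
      fun s => 2 * (Real.tanh (α * s + β u) * (α * 1)) := by
    ext s
    have hw : HasDerivAt (fun s => α * s + β u) (α * 1) s :=
      ((hasDerivAt_id s).const_mul α).add_const _
    exact ((((Real.hasDerivAt_log_cosh _).comp s hw).const_mul 2).const_add (h u)).deriv
  have hwu : HasDerivAt (fun s => α * v + β s) (deriv β u) u := (b1 u).const_add _
  have hwv : HasDerivAt (fun s => α * s + β u) (α * 1) v :=
    ((hasDerivAt_id v).const_mul α).add_const _
  have du := ((h2 u).add ((((Real.hasDerivAt_tanh_one_sub_sq _).comp u hwu).mul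
    (b2 u)).const_mul 2)).deriv
  have dv := ((((Real.hasDerivAt_tanh_one_sub_sq _).comp v hwv).mul_const (α * 1)).const_mul
    2).deriv
  rw [eu, ev]
  refine (congrArg (fun x => -(1 / 2) * x) (congrArg₂ (· + ·) du dv)).trans ?_
  simp only [Function.comp_apply]
  ring

theorem tendsto_curvature_density {α u₀ τ : ℝ} {h β : ℝ → ℝ} {l : Filter ℝ}
    (hh : ContDiff ℝ 2 h) (hβ : ContDiff ℝ 2 β) (hτ : τ ^ 2 = 1)
    (hl : Tendsto (fun p : ℝ × ℝ => Real.tanh (α * p.2 + β p.1)) (𝓝 u₀ ×ˢ l) (𝓝 τ)) :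
    Tendsto (fun p : ℝ × ℝ =>
      -(deriv (deriv h) p.1 / 2) - deriv (deriv β) p.1 * Real.tanh (α * p.2 + β p.1)
        - (α ^ 2 + deriv β p.1 ^ 2) * (1 - Real.tanh (α * p.2 + β p.1) ^ 2)) (𝓝 u₀ ×ˢ l)
      (𝓝 (-(deriv (deriv h) u₀ / 2) - deriv (deriv β) u₀ * τ)) := by
  obtain ⟨-, -, h3⟩ := hasDerivAt_deriv_of_contDiff_two hh
  obtain ⟨-, b2, b3⟩ := hasDerivAt_deriv_of_contDiff_two hβ
  have H : Tendsto (fun p : ℝ × ℝ => deriv (deriv h) p.1) (𝓝 u₀ ×ˢ l) _ :=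
    (h3.tendsto u₀).comp tendsto_fst
  have B : Tendsto (fun p : ℝ × ℝ => deriv (deriv β) p.1) (𝓝 u₀ ×ˢ l) _ :=
    (b3.tendsto u₀).comp tendsto_fst
  have D : Tendsto (fun p : ℝ × ℝ => deriv β p.1) (𝓝 u₀ ×ˢ l) _ :=
    (b2 u₀).continuousAt.tendsto.comp tendsto_fst
  have := (((H.div_const 2).neg).sub (B.mul hl)).sub
    (((D.pow 2).const_add (α ^ 2)).mul ((hl.pow 2).const_sub 1))
  simpa [hτ] using this

theorem deriv_periodic {f : ℝ → ℝ} {U : ℝ} (hf : Function.Periodic f U) :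
    Function.Periodic (deriv f) U := fun x => by
  rw [← deriv_comp_add_const]
  exact congrArg (fun g => deriv g x) (funext hf)

/-- A periodic function whose second derivative is nonnegative has vanishing second derivative. -/
theorem deriv_deriv_eq_zero_of_periodic {h : ℝ → ℝ} {U : ℝ} (hU : 0 < U) (hh : ContDiff ℝ 2 h)
    (hper : Function.Periodic h U) (hnn : ∀ x, 0 ≤ deriv (deriv h) x) (x : ℝ) :
    deriv (deriv h) x = 0 := by
  obtain ⟨-, h2, -⟩ := hasDerivAt_deriv_of_contDiff_two hh
  have hmono : Monotone (deriv h) :=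
    monotone_of_deriv_nonneg (fun x => (h2 x).differentiableAt) hnn
  have hconst : ∀ y, deriv h y = deriv h 0 := fun y => by
    obtain ⟨n, hn⟩ := exists_nat_gt (|y| / U)
    have hn' : |y| < n * U := (div_lt_iff₀ hU).1 hn
    have hp := (deriv_periodic hper).nat_mul n
    have e1 : deriv h (n * U) = deriv h 0 := by simpa using hp 0
    have e2 : deriv h 0 = deriv h (-(n * U)) := by simpa using hp (-(n * U))
    exact le_antisymm ((hmono (abs_lt.1 hn').2.le).trans_eq e1)
      (e2.trans_le (hmono (abs_lt.1 hn').1.le))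
  rw [funext hconst, deriv_const]

theorem curvature_density_sign_and_lintegral {α U u₀ : ℝ} (hα : 0 < α) (hU : 0 < U)
    {h β : ℝ → ℝ} (hh : ContDiff ℝ 2 h) (hβ : ContDiff ℝ 2 β) (hper : Function.Periodic h U)
    (hu₀ : u₀ ∈ Set.Ioo (-U) U) (hb : deriv (deriv β) u₀ ≠ 0) {κ : ℝ × ℝ → ℝ}
    (hκ : ∀ p : ℝ × ℝ, κ p = -(deriv (deriv h) p.1 / 2)
      - deriv (deriv β) p.1 * Real.tanh (α * p.2 + β p.1)
        - (α ^ 2 + deriv β p.1 ^ 2) * (1 - Real.tanh (α * p.2 + β p.1) ^ 2)) :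
    (∃ p : ℝ × ℝ, 0 < κ p) ∧ (∃ p : ℝ × ℝ, κ p < 0) ∧
    ∫⁻ p in (Set.Icc (-U) U) ×ˢ (Set.univ : Set ℝ), ENNReal.ofReal |κ p| = ⊤ := by
  have hβc : ∀ u, Tendsto (fun p : ℝ × ℝ => β p.1) (𝓝 u ×ˢ (⊤ : Filter ℝ)) (𝓝 (β u)) :=
    fun u => (hβ.continuous.tendsto u).comp tendsto_fst
  have htop : ∀ u, Tendsto κ (𝓝 u ×ˢ atTop)
      (𝓝 (-(deriv (deriv h) u / 2) - deriv (deriv β) u * 1)) := fun u => by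
    rw [funext hκ]
    refine tendsto_curvature_density hh hβ (by norm_num) (Real.tendsto_tanh_atTop.comp ?_)
    exact (tendsto_snd.const_mul_atTop hα).atTop_add
      ((hβc u).mono_left (prod_mono le_rfl le_top))
  have hbot : ∀ u, Tendsto κ (𝓝 u ×ˢ atBot)
      (𝓝 (-(deriv (deriv h) u / 2) - deriv (deriv β) u * -1)) := fun u => by
    rw [funext hκ]
    refine tendsto_curvature_density hh hβ (by norm_num) (Real.tendsto_tanh_atBot.comp ?_)
    exact (tendsto_snd.const_mul_atBot hα).atBot_add
      ((hβc u).mono_left (prod_mono le_rfl le_top))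
  refine ⟨?_, ?_, ?_⟩
  · by_contra! hneg
    have h1 : ∀ u, -(deriv (deriv h) u / 2) - deriv (deriv β) u * 1 ≤ 0 := fun u =>
      le_of_tendsto (htop u) (Eventually.of_forall hneg)
    have h2 : ∀ u, -(deriv (deriv h) u / 2) - deriv (deriv β) u * -1 ≤ 0 := fun u =>
      le_of_tendsto (hbot u) (Eventually.of_forall hneg)
    have h0 := deriv_deriv_eq_zero_of_periodic hU hh hper
      (fun u => by linarith [h1 u, h2 u]) u₀
    exact hb (by linarith [h1 u₀, h2 u₀])
  · obtain ⟨-, d2, -⟩ := hasDerivAt_deriv_of_contDiff_two hh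
    obtain ⟨c, -, hc⟩ := exists_deriv_eq_zero hU
      (fun x _ => (d2 x).continuousAt.continuousWithinAt) (by
        simpa using (deriv_periodic hper 0).symm)
    refine ⟨(c, -(β c) / α), ?_⟩
    have e : α * (-(β c) / α) + β c = 0 := by
      field_simp
      ring
    rw [hκ]
    simp only [hc, e, Real.tanh_zero]
    have : 0 < α ^ 2 := by positivity
    nlinarith [sq_nonneg (deriv β c)]
  · have hs : Set.Icc (-U) U ∈ 𝓝 u₀ := Icc_mem_nhds hu₀.1 hu₀.2
    by_cases hc : -(deriv (deriv h) u₀ / 2) - deriv (deriv β) u₀ * 1 = 0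
    · refine lintegral_strip_eq_top (l := atBot) (fun t ht => ?_) hs (hbot u₀) fun hc' => hb ?_
      · obtain ⟨a, ha⟩ := mem_atBot_sets.1 ht
        exact ⟨Set.Iic a, ha, measurableSet_Iic, Real.volume_Iic⟩
      · linarith
    · refine lintegral_strip_eq_top (l := atTop) (fun t ht => ?_) hs (htop u₀) hc
      obtain ⟨a, ha⟩ := mem_atTop_sets.1 ht
      exact ⟨Set.Ici a, ha, measurableSet_Ici, Real.volume_Ici⟩

theorem one_sub_lt_cos_two_mul {α θ : ℝ} (hα : 0 < α) (hθ : θ < thetaPlus α)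
    (h0 : 0 < θ) (hθ' : θ < Real.pi / 4) : 1 - 2 * α ^ 2 < Real.cos (2 * θ) := by
  unfold thetaPlus at hθ
  split_ifs at hθ with h
  · nlinarith [Real.neg_one_le_cos (2 * θ)]
  · have hlt : 2 * θ < Real.arccos (1 - 2 * α ^ 2) := by linarith
    have := Real.strictAntiOn_cos ⟨by linarith, by linarith [Real.pi_pos]⟩
      ⟨Real.arccos_nonneg _, Real.arccos_le_pi _⟩ hlt
    rwa [Real.cos_arccos (by nlinarith) (by nlinarith)] at this

theorem Ppoly_pos {α θ x : ℝ} (hα : 0 < α) (hθ : 1 - 2 * α ^ 2 < Real.cos (2 * θ))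
    (hx : x ^ 2 ≤ 1) : 0 < Ppoly α θ x := by
  have hα2 : 0 < α ^ 2 := by positivity
  have hC : 4 * α ^ 2 * Ccoef α θ ^ 2 = 1 - Real.cos (2 * θ) ^ 2 := by
    rw [← Real.sin_sq, Ccoef]
    field_simp
    ring
  have h1 : 0 < α ^ 2 + Real.cos (2 * θ) - Ccoef α θ ^ 2 := by
    have : 0 < 4 * α ^ 2 * (α ^ 2 + Real.cos (2 * θ) - Ccoef α θ ^ 2) := by
      nlinarith [sq_nonneg (Real.cos (2 * θ))]
    exact pos_of_mul_pos_right this (by positivity)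
  have e : Ppoly α θ x = α ^ 2 * (1 - x ^ 2)
      + x ^ 2 * (α ^ 2 + Real.cos (2 * θ) - Ccoef α θ ^ 2)
      + Ccoef α θ ^ 2 * (x ^ 2 * (1 - x ^ 2)) := by
    unfold Ppoly
    ring
  have h3 : 0 ≤ Ccoef α θ ^ 2 * (x ^ 2 * (1 - x ^ 2)) :=
    mul_nonneg (sq_nonneg _) (mul_nonneg (sq_nonneg _) (by linarith))
  rw [e]
  rcases eq_or_lt_of_le hx with hx | hx
  · rw [hx] at h3 ⊢
    linarith
  · have := mul_pos hα2 (sub_pos.2 hx)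
    have := mul_nonneg (sq_nonneg x) h1.le
    linarith

/-- The horizontal catenoid has points of positive and of negative Gaussian curvature,
and infinite total absolute curvature. -/
theorem statement_15 {α θ : ℝ} (hα : 0 < α)
    (hθmem : θ ∈ Set.Ioo 0 (thetaPlus α) ∩ Set.Ioo 0 (Real.pi / 4))
    (hθzero : Lint α θ = 0)
    (φ φ' β G Gd : ℝ → ℝ)
    (hφ : ∀ u, HasDerivAt φ (φ' u) u) (hφ'c : Continuous φ')
    (hode : ∀ u, (φ' u) ^ 2 = Ppoly α θ (Real.cos (φ u)))
    (hφ0 : φ 0 = 0) (hφ'0 : φ' 0 ≤ 0)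
    (hβ : ∀ u, HasDerivAt β (Ccoef α θ * Real.cos (φ u) ^ 2) u) (hβ0 : β 0 = 0)
    (hGd : ∀ u, Gd u =
      (Ccoef α θ ^ 2 * Real.cos (φ u) ^ 2 - Real.cos (2 * θ)) / (α - φ' u))
    (hG : ∀ u, HasDerivAt G (Gd u) u) (hG0 : G 0 = 0)
    (U : ℝ) (hU : 0 < U) (hUper : ∀ u, φ (u + U) = φ u - Real.pi)
    (lam κ : ℝ × ℝ → ℝ)
    (hlam : ∀ p : ℝ × ℝ, lam p = (Gd p.1 ^ 2 + Ccoef α θ ^ 2) * Real.cosh (α * p.2 + β p.1) ^ 2)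
    (hκ : ∀ p : ℝ × ℝ, κ p = -(1 / 2) *
      (deriv (deriv (fun s => Real.log (lam (s, p.2)))) p.1
        + deriv (deriv (fun s => Real.log (lam (p.1, s)))) p.2)) :
    (∃ p : ℝ × ℝ, 0 < κ p) ∧ (∃ p : ℝ × ℝ, κ p < 0) ∧
    ∫⁻ p in (Set.Icc (-U) U) ×ˢ (Set.univ : Set ℝ), ENNReal.ofReal |κ p| = ⊤ := by
  obtain ⟨⟨h0θ, hθ⟩, -, hθ4⟩ := hθmem
  have hcosθ := one_sub_lt_cos_two_mul hα hθ h0θ hθ4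
  have hC : 0 < Ccoef α θ :=
    div_pos (Real.sin_pos_of_pos_of_lt_pi (by linarith) (by linarith [Real.pi_pos])) (by linarith)
  have hP : ∀ u, 0 < Ppoly α θ (Real.cos (φ u)) := fun u =>
    Ppoly_pos hα hcosθ (Real.cos_sq_le_one _)
  have hφ'neg : ∀ u, φ' u < 0 := fun u => by
    by_contra! hu
    obtain ⟨w, hw⟩ := mem_range_of_exists_le_of_exists_ge hφ'c ⟨0, hφ'0⟩ ⟨u, hu⟩
    have := hode w
    rw [hw] at this
    have := hP w
    simp_all
  have hφ'eq : φ' = fun u => -Real.sqrt (Ppoly α θ (Real.cos (φ u))) := by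
    ext u
    rw [← hode, Real.sqrt_sq_eq_abs, abs_of_neg (hφ'neg u), neg_neg]
  have hderivφ : deriv φ = φ' := funext fun u => (hφ u).deriv
  have hdiffφ : Differentiable ℝ φ := fun u => (hφ u).differentiableAt
  have hφ'reg : ∀ n : ℕ, ContDiff ℝ n φ → ContDiff ℝ n φ' := fun n hn => by
    rw [hφ'eq]
    refine (ContDiff.sqrt ?_ fun u => (hP u).ne').neg
    unfold Ppoly
    have := hn.cos
    fun_prop
  have hφ1 : ContDiff ℝ 1 φ :=
    contDiff_one_iff_deriv.2 ⟨hdiffφ, by rwa [hderivφ]⟩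
  have hφ2 : ContDiff ℝ 2 φ := by
    refine (contDiff_succ_iff_deriv (n := 1)).2 ⟨hdiffφ, by simp, ?_⟩
    rw [hderivφ]
    exact hφ'reg 1 hφ1
  have hφ'2 : ContDiff ℝ 2 φ' := hφ'reg 2 hφ2
  have hGd2 : ContDiff ℝ 2 Gd := by
    rw [funext hGd]
    have := hφ2.cos
    exact ContDiff.div (by fun_prop) (by fun_prop) fun u => by linarith [hφ'neg u]
  have hpos : ∀ u, 0 < Gd u ^ 2 + Ccoef α θ ^ 2 := fun u => by positivity
  have hh2 : ContDiff ℝ 2 fun u => Real.log (Gd u ^ 2 + Ccoef α θ ^ 2) :=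
    ContDiff.log (by fun_prop) fun u => (hpos u).ne'
  have hderivβ : deriv β = fun u => Ccoef α θ * Real.cos (φ u) ^ 2 :=
    funext fun u => (hβ u).deriv
  have hβ2 : ContDiff ℝ 2 β := by
    refine (contDiff_succ_iff_deriv (n := 1)).2 ⟨fun u => (hβ u).differentiableAt, by simp, ?_⟩
    rw [hderivβ]
    have := hφ1.cos
    fun_prop
  have hper : Function.Periodic (fun u => Real.log (Gd u ^ 2 + Ccoef α θ ^ 2)) U := fun u => by
    have hcos : Real.cos (φ (u + U)) ^ 2 = Real.cos (φ u) ^ 2 := by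
      rw [hUper, Real.cos_sub_pi, neg_sq]
    have hcos4 : Real.cos (φ (u + U)) ^ 4 = Real.cos (φ u) ^ 4 := by
      rw [hUper, Real.cos_sub_pi, Even.neg_pow (by decide)]
    have hφ'U : φ' (u + U) = φ' u := by
      simp only [hφ'eq, Ppoly, hcos, hcos4]
    simp only [hGd, hcos, hφ'U]
  obtain ⟨u₀, hu₀, hφu₀⟩ : -(Real.pi / 4) ∈ φ '' Set.Icc 0 U := by
    have hφU : φ U = -Real.pi := by simpa [hφ0] using hUper 0
    refine intermediate_value_Icc' hU.le hdiffφ.continuous.continuousOn ⟨?_, ?_⟩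
    · linarith [Real.pi_pos]
    · linarith [Real.pi_pos]
  have hu₀U : u₀ ≠ U := by
    rintro rfl
    have := hUper 0
    rw [zero_add, hφ0, hφu₀] at this
    linarith [Real.pi_pos]
  have hb : deriv (deriv β) u₀ ≠ 0 := by
    have hd : HasDerivAt (fun u => Ccoef α θ * Real.cos (φ u) ^ 2) _ u₀ :=
      ((hφ u₀).cos.pow 2).const_mul (Ccoef α θ)
    rw [hderivβ, hd.deriv, hφu₀, Real.cos_neg,
      Real.sin_neg, Real.cos_pi_div_four, Real.sin_pi_div_four]
    simp [(hφ'neg u₀).ne, hC.ne']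
  refine curvature_density_sign_and_lintegral hα hU hh2 hβ2 hper
    ⟨by linarith [hu₀.1], lt_of_le_of_ne hu₀.2 hu₀U⟩ hb fun p => ?_
  have hlog : ∀ s t, Real.log (lam (s, t)) =
      Real.log (Gd s ^ 2 + Ccoef α θ ^ 2) + 2 * Real.log (Real.cosh (α * t + β s)) := fun s t => by
    rw [hlam, Real.log_mul (hpos s).ne' (pow_pos (Real.cosh_pos _) 2).ne', Real.log_pow]
    norm_num
  rw [hκ, ← curvature_density_eq hh2 hβ2]
  simp only [hlog]
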